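/- arXiv:2002.07607 — 6 statements merged into one kernel-verified Lean document; each statement's English description precedes it below -/
import Mathlib

section
/- Fix integers k ≥ 1, n ≥ 1, indices i, j with 1 ≤ i < k, 1 ≤ j ≤ k, i odd, and pairs (p,q), (p',q') ∈ {1,…,n}×{1,…,n}. Then: (a) dist(V_→^{i,j}, b^{i,j}_{(p,q)}) < dist(V_→^{i,j}, b^{i+1,j}_{(p',q')}) if and only if p ≤ p'; and (b) dist(V_←^{i+1,j}, b^{i+1,j}_{(p',q')}) < dist(V_←^{i+1,j}, b^{i,j}_{(p,q)}) if and only if p' ≤ p. -/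
open scoped Classical

noncomputable section

/-- Euclidean distance between two points of the plane `ℝ × ℝ`. -/
def edist2 (a b : ℝ × ℝ) : ℝ := Real.sqrt ((a.1 - b.1) ^ 2 + (a.2 - b.2) ^ 2)

/-- The grid scale `L = 10n² + 4n`. -/
def Lc (n : ℕ) : ℝ := 10 * (n : ℝ) ^ 2 + 4 * (n : ℝ)

/-- The ballot box `b^{i,j}_{(p,q)}`. -/
def bbox (n i j p q : ℕ) : ℝ × ℝ :=
  ((if Even i then Lc n * ((i : ℝ) - 1) + 5 * (n : ℝ) ^ 2 + 4 * (p : ℝ)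
    else Lc n * ((i : ℝ) - 1) + 5 * (n : ℝ) ^ 2 + 4 * ((n : ℝ) - (p : ℝ))),
   (if Even j then Lc n * ((j : ℝ) - 1) + 5 * (n : ℝ) ^ 2 + 4 * (q : ℝ)
    else Lc n * ((j : ℝ) - 1) + 5 * (n : ℝ) ^ 2 + 4 * ((n : ℝ) - (q : ℝ))))

/-- The voter position `V_←^{i,j}`. -/
def Vl (n i j : ℕ) : ℝ × ℝ :=
  (Lc n * ((i : ℝ) - 1) + 1, Lc n * ((j : ℝ) - 1) + 5 * (n : ℝ) ^ 2 + 2 * (n : ℝ))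

/-- The voter position `V_→^{i,j}`. -/
def Vr (n i j : ℕ) : ℝ × ℝ :=
  (Lc n * (i : ℝ) - 1, Lc n * ((j : ℝ) - 1) + 5 * (n : ℝ) ^ 2 + 2 * (n : ℝ))

/-- The voter position `V_↑^{i,j}`. -/
def Vu (n i j : ℕ) : ℝ × ℝ :=
  (Lc n * ((i : ℝ) - 1) + 5 * (n : ℝ) ^ 2 + 2 * (n : ℝ), Lc n * ((j : ℝ) - 1) + 1)

/-- The voter position `V_↓^{i,j}`. -/
def Vd (n i j : ℕ) : ℝ × ℝ :=
  (Lc n * ((i : ℝ) - 1) + 5 * (n : ℝ) ^ 2 + 2 * (n : ℝ), Lc n * (j : ℝ) - 1)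

/-- The center position `c^{i,j}` where the red voters sit. -/
def cpos (n i j : ℕ) : ℝ × ℝ :=
  (Lc n * ((i : ℝ) - 1) + 5 * (n : ℝ) ^ 2 + 2 * (n : ℝ),
   Lc n * ((j : ℝ) - 1) + 5 * (n : ℝ) ^ 2 + 2 * (n : ℝ))

/-- Comparison of squared distances: the horizontal offsets `5n² + 4p - 1` and `5n² + 4p' + 1`
decide, because the squared vertical offsets differ by at most `4n²`. -/
theorem sq_offset_lt_iff {n p q p' q' : ℕ} (hn : 1 ≤ n) (hqn : q ≤ n) (hq'n : q' ≤ n) :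
    (5 * (n : ℝ) ^ 2 + 4 * p - 1) ^ 2 + (4 * (q : ℝ) - 2 * n) ^ 2
      < (5 * (n : ℝ) ^ 2 + 4 * p' + 1) ^ 2 + (4 * (q' : ℝ) - 2 * n) ^ 2 ↔ p ≤ p' := by
  have hn0 : (1 : ℝ) ≤ n := by exact_mod_cast hn
  have vertical_bound {r : ℕ} (hr : r ≤ n) : (4 * (r : ℝ) - 2 * n) ^ 2 ≤ 4 * (n : ℝ) ^ 2 := by
    have h : (r : ℝ) ≤ n := by exact_mod_cast hr
    nlinarith [mul_nonneg (Nat.cast_nonneg (α := ℝ) r) (sub_nonneg.2 h)]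
  have hq := vertical_bound hqn
  have hq' := vertical_bound hq'n
  have hq0 := sq_nonneg (4 * (q : ℝ) - 2 * n)
  have hq'0 := sq_nonneg (4 * (q' : ℝ) - 2 * n)
  have hp0 : (0 : ℝ) ≤ p := Nat.cast_nonneg p
  have hp'0 : (0 : ℝ) ≤ p' := Nat.cast_nonneg p'
  have hsum : (0 : ℝ) ≤ 10 * (n : ℝ) ^ 2 + 4 * p + 4 * p' := by positivity
  constructor
  · intro h
    by_contra! hlt
    have hlt' : (p' : ℝ) + 1 ≤ p := by exact_mod_cast hlt
    nlinarith [mul_nonneg hsum (sub_nonneg.2 hlt')]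
  · intro h
    have h' : (p : ℝ) ≤ p' := by exact_mod_cast h
    nlinarith [mul_nonneg hsum (sub_nonneg.2 h')]

/-- The vertical offset of a ballot box from the horizontal axis of its cell, squared. -/
theorem sq_axis_sub_bbox_snd (n i j p q : ℕ) :
    (Lc n * ((j : ℝ) - 1) + 5 * (n : ℝ) ^ 2 + 2 * (n : ℝ) - (bbox n i j p q).2) ^ 2
      = (4 * (q : ℝ) - 2 * n) ^ 2 := by
  simp only [bbox]
  split_ifs <;> ring

theorem bbox_fst_of_odd {n i j p q : ℕ} (hi : Odd i) :
    (bbox n i j p q).1 = Lc n * ((i : ℝ) - 1) + 5 * (n : ℝ) ^ 2 + 4 * ((n : ℝ) - p) := by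
  simp [bbox, Nat.not_even_iff_odd.2 hi]

theorem bbox_fst_succ_of_odd {n i j p q : ℕ} (hi : Odd i) :
    (bbox n (i + 1) j p q).1 = Lc n * (i : ℝ) + 5 * (n : ℝ) ^ 2 + 4 * (p : ℝ) := by
  simp [bbox, hi.add_one]

/-- Claim 1 of the hardness proof (odd `i`): the voters at `V_→^{i,j}` are
closer to `b^{i,j}_{(p,q)}` than to `b^{i+1,j}_{(p',q')}` iff `p ≤ p'`, and the
voters at `V_←^{i+1,j}` are closer to `b^{i+1,j}_{(p',q')}` iff `p' ≤ p`. -/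
theorem claim_x_axis (k n i j p q p' q' : ℕ)
    (hk : 1 ≤ k) (hn : 1 ≤ n)
    (hi1 : 1 ≤ i) (hik : i < k) (hj1 : 1 ≤ j) (hjk : j ≤ k) (hodd : Odd i)
    (hp1 : 1 ≤ p) (hpn : p ≤ n) (hq1 : 1 ≤ q) (hqn : q ≤ n)
    (hp'1 : 1 ≤ p') (hp'n : p' ≤ n) (hq'1 : 1 ≤ q') (hq'n : q' ≤ n) :
    (edist2 (Vr n i j) (bbox n i j p q) < edist2 (Vr n i j) (bbox n (i + 1) j p' q')
      ↔ p ≤ p') ∧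
    (edist2 (Vl n (i + 1) j) (bbox n (i + 1) j p' q') < edist2 (Vl n (i + 1) j) (bbox n i j p q)
      ↔ p' ≤ p) := by
  simp only [edist2, Vr, Vl]
  rw [Real.sqrt_lt_sqrt_iff (by positivity), Real.sqrt_lt_sqrt_iff (by positivity)]
  simp only [sq_axis_sub_bbox_snd, bbox_fst_of_odd hodd, bbox_fst_succ_of_odd hodd]
  rw [← sq_offset_lt_iff (p := p) (p' := p') hn hqn hq'n,
    ← sq_offset_lt_iff (p := p') (p' := p) hn hq'n hqn]
  simp only [Lc]
  push_cast
  constructor <;> ring_nf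
end
end

section
/- Fix integers k ≥ 1, n ≥ 1, indices i, j with 1 ≤ i ≤ k, 1 ≤ j < k, j odd, and pairs (p,q), (p',q') ∈ {1,…,n}×{1,…,n}. Then: (a) dist(V_↓^{i,j}, b^{i,j}_{(p,q)}) < dist(V_↓^{i,j}, b^{i,j+1}_{(p',q')}) if and only if q ≤ q'; and (b) dist(V_↑^{i,j+1}, b^{i,j+1}_{(p',q')}) < dist(V_↑^{i,j+1}, b^{i,j}_{(p,q)}) if and only if q' ≤ q. -/
open scoped Classical

noncomputable section

/-- Shifting one vertical offset down by `1` and the other up by `1` outweighs horizontal offsets of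
size at most `2n`. -/
lemma sqrt_offset_lt_iff {n s t : ℕ} {a b u v : ℝ} (ha : a ^ 2 ≤ 4 * (n : ℝ) ^ 2)
    (hb : b ^ 2 ≤ 4 * (n : ℝ) ^ 2) (hu : u ^ 2 = (5 * (n : ℝ) ^ 2 + 4 * s - 1) ^ 2)
    (hv : v ^ 2 = (5 * (n : ℝ) ^ 2 + 4 * t + 1) ^ 2) (ht : 1 ≤ t) :
    √(a ^ 2 + u ^ 2) < √(b ^ 2 + v ^ 2) ↔ s ≤ t := by
  rw [Real.sqrt_lt_sqrt_iff (by positivity), hu, hv]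
  have hs0 : (0 : ℝ) ≤ s := Nat.cast_nonneg s
  have ht1 : (1 : ℝ) ≤ t := by exact_mod_cast ht
  have hn0 := sq_nonneg (n : ℝ)
  constructor
  · intro h
    by_contra! hts
    have hts' : (t : ℝ) + 1 ≤ s := by exact_mod_cast hts
    have := pow_le_pow_left₀ (by positivity)
      (show 5 * (n : ℝ) ^ 2 + 4 * t + 3 ≤ 5 * (n : ℝ) ^ 2 + 4 * s - 1 by linarith) 2
    nlinarith [sq_nonneg a]
  · intro h
    have hst : (s : ℝ) ≤ t := by exact_mod_cast h
    have : (5 * (n : ℝ) ^ 2 + 4 * s - 1) ^ 2 ≤ (5 * (n : ℝ) ^ 2 + 4 * t - 1) ^ 2 :=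
      sq_le_sq' (by linarith) (by linarith)
    nlinarith [sq_nonneg b]

/-- A ballot box is within horizontal distance `2n` of the vertical axis of its cell. -/
lemma sq_sub_bbox_fst_le {n p : ℕ} (i j q : ℕ) (hp : p ≤ n) :
    (Lc n * ((i : ℝ) - 1) + 5 * (n : ℝ) ^ 2 + 2 * (n : ℝ) - (bbox n i j p q).1) ^ 2
      ≤ 4 * (n : ℝ) ^ 2 := by
  have hp0 : (0 : ℝ) ≤ p := Nat.cast_nonneg p
  have hpn : (p : ℝ) ≤ n := by exact_mod_cast hp
  rw [show 4 * (n : ℝ) ^ 2 = (2 * n) ^ 2 by ring]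
  unfold bbox
  split_ifs <;> exact sq_le_sq' (by linarith) (by linarith)

/-- Claim 2 of the hardness proof (odd `j`): the voters at `V_↓^{i,j}` are
closer to `b^{i,j}_{(p,q)}` than to `b^{i,j+1}_{(p',q')}` iff `q ≤ q'`, and the
voters at `V_↑^{i,j+1}` are closer to `b^{i,j+1}_{(p',q')}` iff `q' ≤ q`. -/
theorem claim_y_axis (k n i j p q p' q' : ℕ)
    (hk : 1 ≤ k) (hn : 1 ≤ n)
    (hi1 : 1 ≤ i) (hik : i ≤ k) (hj1 : 1 ≤ j) (hjk : j < k) (hodd : Odd j)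
    (hp1 : 1 ≤ p) (hpn : p ≤ n) (hq1 : 1 ≤ q) (hqn : q ≤ n)
    (hp'1 : 1 ≤ p') (hp'n : p' ≤ n) (hq'1 : 1 ≤ q') (hq'n : q' ≤ n) :
    (edist2 (Vd n i j) (bbox n i j p q) < edist2 (Vd n i j) (bbox n i (j + 1) p' q')
      ↔ q ≤ q') ∧
    (edist2 (Vu n i (j + 1)) (bbox n i (j + 1) p' q') < edist2 (Vu n i (j + 1)) (bbox n i j p q)
      ↔ q' ≤ q) := by
  have hj : ¬ Even j := Nat.not_even_iff_odd.mpr hodd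
  have hj' : Even (j + 1) := hodd.add_one
  refine ⟨sqrt_offset_lt_iff (sq_sub_bbox_fst_le i j q hpn)
      (sq_sub_bbox_fst_le i (j + 1) q' hp'n) ?_ ?_ hq'1,
    sqrt_offset_lt_iff (sq_sub_bbox_fst_le i (j + 1) q' hp'n)
      (sq_sub_bbox_fst_le i j q hpn) ?_ ?_ hq1⟩ <;>
  · simp only [Vd, Vu, bbox, hj, hj', if_true, if_false, Lc]
    push_cast
    ring
end
end

section
/- Fix integers k ≥ 1, n ≥ 1, indices i, j with 1 ≤ i < k, 1 ≤ j ≤ k (of arbitrary parity), and pairs (p,q), (p',q') ∈ {1,…,n}×{1,…,n}. Then the following conjunction holds if and only if p = p': the point V_→^{i,j} is strictly closer to b^{i,j}_{(p,q)} than to b^{i+1,j}_{(p',q')}, and the point V_←^{i+1,j} is strictly closer to b^{i+1,j}_{(p',q')} than to b^{i,j}_{(p,q)}. -/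
open scoped Classical

noncomputable section

theorem edist2_lt_edist2_iff (a b c d : ℝ × ℝ) :
    edist2 a b < edist2 c d ↔
      (a.1 - b.1) ^ 2 + (a.2 - b.2) ^ 2 < (c.1 - d.1) ^ 2 + (c.2 - d.2) ^ 2 :=
  Real.sqrt_lt_sqrt_iff (by positivity)

/-- A box at horizontal distance at least `4` further from the border than the opposite box
loses the voter on its own side, whatever the vertical offsets `e` and `e'`. -/
theorem sq_add_sq_lt_of_add_four_le {N d d' e e' : ℝ} (hN : 0 < N) (hd' : 5 * N ^ 2 ≤ d')
    (he' : e' ^ 2 ≤ 4 * N ^ 2) (h : d' + 4 ≤ d) :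
    (d' + 1) ^ 2 + e' ^ 2 < (d - 1) ^ 2 + e ^ 2 := by
  have hN2 : 0 < N ^ 2 := by positivity
  nlinarith [mul_nonneg (sub_nonneg.2 h) (by linarith : 0 ≤ d + d'), sq_nonneg e]

/-- For boxes at equal horizontal distance `d` from the border, each border voter prefers the box
on its own side. -/
theorem sub_one_sq_add_sq_lt {N d e e' : ℝ} (hN : 0 < N) (hd : 5 * N ^ 2 ≤ d)
    (he : e ^ 2 ≤ 4 * N ^ 2) :
    (d - 1) ^ 2 + e ^ 2 < (d + 1) ^ 2 + e' ^ 2 := by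
  have hN2 : 0 < N ^ 2 := by positivity
  nlinarith [sq_nonneg e']

/-- The horizontal distance of the box `b^{i,j}_{(p,q)}` from the border between cells `i`
and `i + 1`. -/
def borderDist (n i p : ℕ) : ℝ :=
  5 * (n : ℝ) ^ 2 + 4 * (if Even i then (n : ℝ) - (p : ℝ) else (p : ℝ))

/-- The vertical offset of the box `b^{i,j}_{(p,q)}` from the middle of its cell. -/
def midOffset (n j q : ℕ) : ℝ :=
  if Even j then 4 * (q : ℝ) - 2 * (n : ℝ) else 2 * (n : ℝ) - 4 * (q : ℝ)

theorem bbox_eq_left (n i j p q : ℕ) :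
    bbox n i j p q = (Lc n * (i : ℝ) - borderDist n i p,
      Lc n * ((j : ℝ) - 1) + 5 * (n : ℝ) ^ 2 + 2 * (n : ℝ) + midOffset n j q) := by
  unfold bbox borderDist midOffset Lc
  ext <;> dsimp only <;> split_ifs <;> ring

theorem bbox_succ_eq_right (n i j p q : ℕ) :
    bbox n (i + 1) j p q = (Lc n * (i : ℝ) + borderDist n i p,
      Lc n * ((j : ℝ) - 1) + 5 * (n : ℝ) ^ 2 + 2 * (n : ℝ) + midOffset n j q) := by
  unfold bbox borderDist midOffset Lc
  simp only [Nat.even_add_one]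
  push_cast
  ext <;> dsimp only <;> split_ifs <;> ring

theorem le_borderDist {n p : ℕ} (i : ℕ) (hpn : p ≤ n) : 5 * (n : ℝ) ^ 2 ≤ borderDist n i p := by
  have hp : (p : ℝ) ≤ n := by exact_mod_cast hpn
  have hp0 : (0 : ℝ) ≤ p := p.cast_nonneg
  unfold borderDist
  split_ifs <;> linarith

theorem midOffset_sq_le {n q : ℕ} (j : ℕ) (hqn : q ≤ n) :
    midOffset n j q ^ 2 ≤ 4 * (n : ℝ) ^ 2 := by
  have hq : (q : ℝ) ≤ n := by exact_mod_cast hqn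
  have hq0 : (0 : ℝ) ≤ q := q.cast_nonneg
  unfold midOffset
  split_ifs <;> nlinarith [mul_nonneg hq0 (sub_nonneg.2 hq)]

theorem borderDist_separated (n i : ℕ) {p p' : ℕ} (h : p ≠ p') :
    borderDist n i p' + 4 ≤ borderDist n i p ∨ borderDist n i p + 4 ≤ borderDist n i p' := by
  unfold borderDist
  rcases lt_or_gt_of_ne h with h | h
  all_goals
    have h' := Nat.cast_le (α := ℝ).2 (Nat.succ_le_of_lt h)
    push_cast at h'
    split_ifs
  · left; linarith
  · right; linarith
  · right; linarith
  · left; linarith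

/-- Both border voters between horizontally adjacent cells vote in their own
cell's box if and only if the first coordinates of the chosen pairs agree:
`V_→^{i,j}` is strictly closer to `b^{i,j}_{(p,q)}` and `V_←^{i+1,j}` is
strictly closer to `b^{i+1,j}_{(p',q')}` iff `p = p'`. -/
theorem border_voters_iff_eq (k n i j p q p' q' : ℕ)
    (hk : 1 ≤ k) (hn : 1 ≤ n)
    (hi1 : 1 ≤ i) (hik : i < k) (hj1 : 1 ≤ j) (hjk : j ≤ k)
    (hp1 : 1 ≤ p) (hpn : p ≤ n) (hq1 : 1 ≤ q) (hqn : q ≤ n)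
    (hp'1 : 1 ≤ p') (hp'n : p' ≤ n) (hq'1 : 1 ≤ q') (hq'n : q' ≤ n) :
    ((edist2 (Vr n i j) (bbox n i j p q) < edist2 (Vr n i j) (bbox n (i + 1) j p' q')) ∧
     (edist2 (Vl n (i + 1) j) (bbox n (i + 1) j p' q') <
        edist2 (Vl n (i + 1) j) (bbox n i j p q)))
      ↔ p = p' := by
  have hN : (0 : ℝ) < n := by exact_mod_cast hn
  have hd := le_borderDist i hpn
  have hd' := le_borderDist i hp'n
  have he := midOffset_sq_le j hqn
  have he' := midOffset_sq_le j hq'n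
  have h_right : edist2 (Vr n i j) (bbox n i j p q) < edist2 (Vr n i j) (bbox n (i + 1) j p' q') ↔
      (borderDist n i p - 1) ^ 2 + midOffset n j q ^ 2 <
        (borderDist n i p' + 1) ^ 2 + midOffset n j q' ^ 2 := by
    rw [edist2_lt_edist2_iff, bbox_succ_eq_right, bbox_eq_left]
    unfold Vr
    ring_nf
  have h_left : edist2 (Vl n (i + 1) j) (bbox n (i + 1) j p' q') <
        edist2 (Vl n (i + 1) j) (bbox n i j p q) ↔
      (borderDist n i p' - 1) ^ 2 + midOffset n j q' ^ 2 <
        (borderDist n i p + 1) ^ 2 + midOffset n j q ^ 2 := by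
    rw [edist2_lt_edist2_iff, bbox_succ_eq_right, bbox_eq_left]
    unfold Vl
    push_cast
    ring_nf
  rw [h_right, h_left]
  constructor
  · rintro ⟨hr, hl⟩
    by_contra hne
    rcases borderDist_separated n i hne with h | h
    · exact hr.not_gt (sq_add_sq_lt_of_add_four_le hN hd' he' h)
    · exact hl.not_gt (sq_add_sq_lt_of_add_four_le hN hd he h)
  · rintro rfl
    exact ⟨sub_one_sq_add_sq_lt hN hd he, sub_one_sq_add_sq_lt hN hd he'⟩
end
end

section
/- Let k, n ≥ 1 and let S_{i,j} ⊆ {1,…,n}×{1,…,n} be nonempty for all i, j ∈ {1,…,k}. Suppose s = (s_{i,j})_{i,j∈{1,…,k}} is a grid-tiling solution, and let B' = { b^{i,j}_{s_{i,j}} : i, j ∈ {1,…,k} }. Then for every i, j ∈ {1,…,k}, each of the five voter positions c^{i,j}, V_←^{i,j}, V_→^{i,j}, V_↑^{i,j}, V_↓^{i,j} has a unique nearest box in B', and that nearest box is b^{i,j}_{s_{i,j}}. Consequently, at every box of B' the number of red voters voting there exceeds the number of blue voters voting there by exactly one. -/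
open scoped Classical

noncomputable section

/-- `b` is the (unique, strictly) nearest box of `B'` to the position `v`. -/
def nearestIn (B' : Set (ℝ × ℝ)) (v b : ℝ × ℝ) : Prop :=
  b ∈ B' ∧ ∀ b' ∈ B', b' ≠ b → edist2 v b < edist2 v b'

/-- The five voter positions of the cell `(i,j)`. -/
def fivePos (n i j : ℕ) : Set (ℝ × ℝ) :=
  {cpos n i j, Vl n i j, Vr n i j, Vu n i j, Vd n i j}

/-- All voter positions of the instance. -/
def allPositions (k n : ℕ) : Set (ℝ × ℝ) :=
  {v | ∃ i j, 1 ≤ i ∧ i ≤ k ∧ 1 ≤ j ∧ j ≤ k ∧ v ∈ fivePos n i j}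

/-- The set of available ballot boxes determined by the grid-tiling sets `S`. -/
def Bset (k n : ℕ) (S : ℕ → ℕ → Set (ℕ × ℕ)) : Set (ℝ × ℝ) :=
  {x | ∃ i j p q, 1 ≤ i ∧ i ≤ k ∧ 1 ≤ j ∧ j ≤ k ∧ (p, q) ∈ S i j ∧ x = bbox n i j p q}

/-- The available ballot boxes of the cell `(i,j)`. -/
def Bij (n i j : ℕ) (S : ℕ → ℕ → Set (ℕ × ℕ)) : Set (ℝ × ℝ) :=
  {x | ∃ p q, (p, q) ∈ S i j ∧ x = bbox n i j p q}

/-- The number of red voters voting at box `b` when the open boxes are `B'`: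
`4·5^{(i-1)k+(j-1)} + 1` red voters sit at each center `c^{i,j}`. -/
def redCount (k n : ℕ) (B' : Set (ℝ × ℝ)) (b : ℝ × ℝ) : ℕ :=
  ∑ i ∈ Finset.Icc 1 k, ∑ j ∈ Finset.Icc 1 k,
    if nearestIn B' (cpos n i j) b then 4 * 5 ^ ((i - 1) * k + (j - 1)) + 1 else 0

/-- The number of blue voters voting at box `b` when the open boxes are `B'`:
`5^{(i-1)k+(j-1)}` blue voters sit at each of `V_←^{i,j}`, `V_→^{i,j}`,
`V_↑^{i,j}`, `V_↓^{i,j}`. -/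
def blueCount (k n : ℕ) (B' : Set (ℝ × ℝ)) (b : ℝ × ℝ) : ℕ :=
  ∑ i ∈ Finset.Icc 1 k, ∑ j ∈ Finset.Icc 1 k,
    ((if nearestIn B' (Vl n i j) b then 5 ^ ((i - 1) * k + (j - 1)) else 0) +
     (if nearestIn B' (Vr n i j) b then 5 ^ ((i - 1) * k + (j - 1)) else 0) +
     (if nearestIn B' (Vu n i j) b then 5 ^ ((i - 1) * k + (j - 1)) else 0) +
     (if nearestIn B' (Vd n i j) b then 5 ^ ((i - 1) * k + (j - 1)) else 0))

/-- Red wins at box `b`: strictly more red than blue voters vote at `b`. -/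
def redWins (k n : ℕ) (B' : Set (ℝ × ℝ)) (b : ℝ × ℝ) : Prop :=
  blueCount k n B' b < redCount k n B' b

/-- `s` is a solution of the grid-tiling instance `S`. -/
def IsGridSolution (k : ℕ) (S : ℕ → ℕ → Set (ℕ × ℕ)) (s : ℕ → ℕ → ℕ × ℕ) : Prop :=
  (∀ i j, 1 ≤ i → i ≤ k → 1 ≤ j → j ≤ k → s i j ∈ S i j) ∧
  (∀ i j, 1 ≤ i → i < k → 1 ≤ j → j ≤ k → (s i j).1 = (s (i + 1) j).1) ∧
  (∀ i j, 1 ≤ i → i ≤ k → 1 ≤ j → j < k → (s i j).2 = (s i (j + 1)).2)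

/-- The common coordinate function of the ballot boxes. -/
def boxCoord (n i p : ℕ) : ℝ :=
  if Even i then Lc n * ((i : ℝ) - 1) + 5 * (n : ℝ) ^ 2 + 4 * (p : ℝ)
  else Lc n * ((i : ℝ) - 1) + 5 * (n : ℝ) ^ 2 + 4 * ((n : ℝ) - (p : ℝ))

theorem bbox_eq (n i j p q : ℕ) : bbox n i j p q = (boxCoord n i p, boxCoord n j q) := rfl

theorem Lc_nonneg (n : ℕ) : 0 ≤ Lc n := by unfold Lc; positivity

theorem le_boxCoord {n i p : ℕ} (hp : p ≤ n) :
    Lc n * ((i : ℝ) - 1) + 5 * (n : ℝ) ^ 2 ≤ boxCoord n i p := by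
  have : (p : ℝ) ≤ n := by exact_mod_cast hp
  have : (0 : ℝ) ≤ p := p.cast_nonneg
  unfold boxCoord
  split_ifs <;> linarith

theorem boxCoord_le {n i p : ℕ} (hp : p ≤ n) :
    boxCoord n i p ≤ Lc n * ((i : ℝ) - 1) + 5 * (n : ℝ) ^ 2 + 4 * n := by
  have : (p : ℝ) ≤ n := by exact_mod_cast hp
  have : (0 : ℝ) ≤ p := p.cast_nonneg
  unfold boxCoord
  split_ifs <;> linarith

/-- Boxes with the same index in consecutive cells are mirror images of each other. -/
theorem boxCoord_add_boxCoord_succ (n i p : ℕ) :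
    boxCoord n i p + boxCoord n (i + 1) p = 2 * (Lc n * i) := by
  unfold boxCoord Lc
  by_cases h : Even i
  · simp only [h, Nat.even_add_one, not_true_eq_false, if_true, if_false]
    push_cast; ring
  · simp only [h, Nat.even_add_one, not_false_eq_true, if_true, if_false]
    push_cast; ring

theorem Lc_mul_add_le {n i i' : ℕ} (d : ℕ) (h : i + d ≤ i') :
    Lc n * ((i : ℝ) - 1) + Lc n * d ≤ Lc n * ((i' : ℝ) - 1) := by
  have : (i : ℝ) + d ≤ i' := by exact_mod_cast h
  nlinarith [Lc_nonneg n]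

theorem boxCoord_injective {n i i' p p' : ℕ} (hn : 1 ≤ n) (hp : p ≤ n) (hp' : p' ≤ n)
    (h : boxCoord n i p = boxCoord n i' p') : i = i' := by
  have hn' : (1 : ℝ) ≤ n := by exact_mod_cast hn
  have hL : Lc n = 10 * (n : ℝ) ^ 2 + 4 * n := rfl
  have h1 := le_boxCoord (i := i) hp
  have h2 := boxCoord_le (i := i) hp
  have h3 := le_boxCoord (i := i') hp'
  have h4 := boxCoord_le (i := i') hp'
  rcases lt_trichotomy i i' with hlt | rfl | hlt
  · have := Lc_mul_add_le (n := n) 1 hlt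
    push_cast at this
    nlinarith
  · rfl
  · have := Lc_mul_add_le (n := n) 1 hlt
    push_cast at this
    nlinarith

/-- The coordinate of the middle of the `i`-th cell. -/
def midCoord (n i : ℕ) : ℝ := Lc n * ((i : ℝ) - 1) + 5 * (n : ℝ) ^ 2 + 2 * (n : ℝ)

theorem sq_midCoord_sub_boxCoord_le {n p : ℕ} (i : ℕ) (hp : p ≤ n) :
    (midCoord n i - boxCoord n i p) ^ 2 ≤ 4 * (n : ℝ) ^ 2 := by
  have h1 := le_boxCoord (i := i) hp
  have h2 := boxCoord_le (i := i) hp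
  unfold midCoord
  nlinarith

theorem le_sq_midCoord_sub_boxCoord {n i i' p : ℕ} (hp : p ≤ n) (h : i ≠ i') :
    (10 * (n : ℝ) ^ 2 + 2 * n) ^ 2 ≤ (midCoord n i - boxCoord n i' p) ^ 2 := by
  have hL : Lc n = 10 * (n : ℝ) ^ 2 + 4 * n := rfl
  have h1 := le_boxCoord (i := i') hp
  have h2 := boxCoord_le (i := i') hp
  rw [sq_le_sq, abs_of_nonneg (by positivity), le_abs]
  unfold midCoord
  rcases h.lt_or_gt with hlt | hlt
  · right
    have := Lc_mul_add_le (n := n) 1 hlt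
    push_cast at this
    linarith
  · left
    have := Lc_mul_add_le (n := n) 1 hlt
    push_cast at this
    linarith

/-- `t` is the coordinate of a voter next to one of the two ends of the `i`-th cell. -/
def IsEndCoord (n i : ℕ) (t : ℝ) : Prop :=
  t = Lc n * ((i : ℝ) - 1) + 1 ∨ t = Lc n * (i : ℝ) - 1

theorem IsEndCoord.sq_sub_boxCoord_le {n i p : ℕ} {t : ℝ} (ht : IsEndCoord n i t)
    (hn : 1 ≤ n) (hp : p ≤ n) :
    (t - boxCoord n i p) ^ 2 ≤ (5 * (n : ℝ) ^ 2 + 4 * n - 1) ^ 2 := by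
  have hn' : (1 : ℝ) ≤ n := by exact_mod_cast hn
  have hL : Lc n = 10 * (n : ℝ) ^ 2 + 4 * n := rfl
  have h1 := le_boxCoord (i := i) hp
  have h2 := boxCoord_le (i := i) hp
  apply sq_le_sq'
  · rcases ht with rfl | rfl <;> nlinarith
  · rcases ht with rfl | rfl <;> nlinarith

/-- A voter at an end of a cell is closer to the box of this cell than to the boxes of other
cells, provided that the boxes in the adjacent cells are mirror images of it. -/
theorem IsEndCoord.sq_sub_boxCoord_add_le {n i i' p p' : ℕ} {t : ℝ} (ht : IsEndCoord n i t)
    (hn : 1 ≤ n) (hp : p ≤ n) (hp' : p' ≤ n) (hi : i ≠ i')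
    (h₁ : i' = i + 1 → p' = p) (h₂ : i = i' + 1 → p' = p) :
    (t - boxCoord n i p) ^ 2 + 20 * (n : ℝ) ^ 2 ≤ (t - boxCoord n i' p') ^ 2 := by
  have hn' : (1 : ℝ) ≤ n := by exact_mod_cast hn
  have hL : Lc n = 10 * (n : ℝ) ^ 2 + 4 * n := rfl
  have b1 := le_boxCoord (i := i) hp
  have b2 := boxCoord_le (i := i) hp
  have b3 := le_boxCoord (i := i') hp'
  have b4 := boxCoord_le (i := i') hp'
  have hown := ht.sq_sub_boxCoord_le hn hp
  have key : 15 * (n : ℝ) ^ 2 + 4 * n - 1 ≤ |t - boxCoord n i' p'| →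
      (t - boxCoord n i p) ^ 2 + 20 * (n : ℝ) ^ 2 ≤ (t - boxCoord n i' p') ^ 2 := by
    intro h
    have h0 : 0 ≤ 15 * (n : ℝ) ^ 2 + 4 * n - 1 := by nlinarith
    have := pow_le_pow_left₀ h0 h 2
    rw [sq_abs] at this
    nlinarith [mul_nonneg (sq_nonneg (n : ℝ)) (sub_nonneg.2 hn'),
      mul_nonneg (sq_nonneg (n : ℝ)) (sq_nonneg (n : ℝ))]
  rcases hi.lt_or_gt with hlt | hlt
  · rcases ht with rfl | rfl
    · have := Lc_mul_add_le (n := n) 1 hlt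
      push_cast at this
      apply key
      rw [le_abs]
      right; linarith
    · rcases (Nat.succ_le_of_lt hlt).eq_or_lt with he | h2
      · obtain rfl : i' = i + 1 := he.symm
        obtain rfl := h₁ rfl
        have := boxCoord_add_boxCoord_succ n i p'
        have hX : boxCoord n (i + 1) p' = 2 * (Lc n * i) - boxCoord n i p' := by linarith
        rw [hX]
        nlinarith
      · have := Lc_mul_add_le (n := n) (i := i) 2 h2
        push_cast at this
        apply key
        rw [le_abs]
        right; nlinarith
  · rcases ht with rfl | rfl
    · rcases (Nat.succ_le_of_lt hlt).eq_or_lt with he | h2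
      · obtain rfl : i = i' + 1 := he.symm
        obtain rfl := h₂ rfl
        have := boxCoord_add_boxCoord_succ n i' p'
        have hX : boxCoord n i' p' = 2 * (Lc n * i') - boxCoord n (i' + 1) p' := by linarith
        rw [hX]
        push_cast at b1 b2 ⊢
        nlinarith
      · have := Lc_mul_add_le (n := n) (i := i') 2 h2
        push_cast at this
        apply key
        rw [le_abs]
        left; nlinarith
    · have := Lc_mul_add_le (n := n) 1 hlt
      push_cast at this
      apply key
      rw [le_abs]
      left; linarith

theorem edist2_lt_edist2 {v b b' : ℝ × ℝ}
    (h : (v.1 - b.1) ^ 2 + (v.2 - b.2) ^ 2 < (v.1 - b'.1) ^ 2 + (v.2 - b'.2) ^ 2) :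
    edist2 v b < edist2 v b' :=
  Real.sqrt_lt_sqrt (by positivity) h

theorem nearestIn.eq {B' : Set (ℝ × ℝ)} {v b b' : ℝ × ℝ} (h : nearestIn B' v b)
    (h' : nearestIn B' v b') : b = b' := by
  by_contra hne
  exact lt_asymm (h.2 b' h'.1 (Ne.symm hne)) (h'.2 b h.1 hne)

theorem sq_add_lt_of_midCoord {n i i' j j' p p' q q' : ℕ} (hn : 1 ≤ n) (hp : p ≤ n)
    (hp' : p' ≤ n) (hq : q ≤ n) (hq' : q' ≤ n) (hne : i ≠ i' ∨ j ≠ j') :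
    (midCoord n i - boxCoord n i p) ^ 2 + (midCoord n j - boxCoord n j q) ^ 2 <
      (midCoord n i - boxCoord n i' p') ^ 2 + (midCoord n j - boxCoord n j' q') ^ 2 := by
  have hn' : (1 : ℝ) ≤ n := by exact_mod_cast hn
  have h1 := sq_midCoord_sub_boxCoord_le i hp
  have h2 := sq_midCoord_sub_boxCoord_le j hq
  have h3 : 8 * (n : ℝ) ^ 2 < (10 * (n : ℝ) ^ 2 + 2 * n) ^ 2 := by
    have : 12 * (n : ℝ) ≤ 10 * (n : ℝ) ^ 2 + 2 * n := by nlinarith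
    nlinarith
  rcases hne with hi | hj
  · have := le_sq_midCoord_sub_boxCoord hp' hi
    nlinarith [sq_nonneg (midCoord n j - boxCoord n j' q')]
  · have := le_sq_midCoord_sub_boxCoord hq' hj
    nlinarith [sq_nonneg (midCoord n i - boxCoord n i' p')]

theorem IsEndCoord.sq_add_lt {n i i' j j' p p' q q' : ℕ} {t : ℝ} (ht : IsEndCoord n i t)
    (hn : 1 ≤ n) (hp : p ≤ n) (hp' : p' ≤ n) (hq : q ≤ n) (hq' : q' ≤ n)
    (hne : i ≠ i' ∨ j ≠ j') (h₁ : j = j' → i' = i + 1 → p' = p)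
    (h₂ : j = j' → i = i' + 1 → p' = p) :
    (t - boxCoord n i p) ^ 2 + (midCoord n j - boxCoord n j q) ^ 2 <
      (t - boxCoord n i' p') ^ 2 + (midCoord n j - boxCoord n j' q') ^ 2 := by
  have hn' : (1 : ℝ) ≤ n := by exact_mod_cast hn
  have h3 := sq_midCoord_sub_boxCoord_le j hq
  by_cases hj : j = j'
  · have := ht.sq_sub_boxCoord_add_le hn hp hp' (hne.resolve_right (not_not.2 hj)) (h₁ hj) (h₂ hj)
    nlinarith [sq_nonneg (midCoord n j - boxCoord n j' q')]
  · have h4 := ht.sq_sub_boxCoord_le hn hp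
    have h5 := le_sq_midCoord_sub_boxCoord hq' hj
    have h6 : (5 * (n : ℝ) ^ 2 + 4 * n - 1) ^ 2 + 4 * (n : ℝ) ^ 2 <
        (10 * (n : ℝ) ^ 2 + 2 * n) ^ 2 := by
      have : (n : ℝ) ^ 2 ≤ ((n : ℝ) ^ 2) ^ 2 := by nlinarith
      nlinarith
    nlinarith [sq_nonneg (t - boxCoord n i' p')]

/-- If `s` is a grid-tiling solution and `B'` is the corresponding set of
ballot boxes, then every one of the five voter positions of each cell `(i,j)`
has `b^{i,j}_{s_{i,j}}` as its unique nearest box of `B'`, and consequently at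
every box of `B'` red beats blue by exactly one vote. -/
theorem grid_solution_gives_win (k n : ℕ) (hk : 1 ≤ k) (hn : 1 ≤ n)
    (S : ℕ → ℕ → Set (ℕ × ℕ))
    (hSsub : ∀ i j, 1 ≤ i → i ≤ k → 1 ≤ j → j ≤ k →
      ∀ pq ∈ S i j, 1 ≤ pq.1 ∧ pq.1 ≤ n ∧ 1 ≤ pq.2 ∧ pq.2 ≤ n)
    (hSne : ∀ i j, 1 ≤ i → i ≤ k → 1 ≤ j → j ≤ k → (S i j).Nonempty)
    (s : ℕ → ℕ → ℕ × ℕ) (hs : IsGridSolution k S s)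
    (B' : Set (ℝ × ℝ))
    (hB' : B' = {x | ∃ i j, 1 ≤ i ∧ i ≤ k ∧ 1 ≤ j ∧ j ≤ k ∧
      x = bbox n i j (s i j).1 (s i j).2}) :
    (∀ i j, 1 ≤ i → i ≤ k → 1 ≤ j → j ≤ k →
      ∀ v ∈ fivePos n i j, nearestIn B' v (bbox n i j (s i j).1 (s i j).2)) ∧
    (∀ b ∈ B', redCount k n B' b = blueCount k n B' b + 1) := by
  obtain ⟨hsS, hrow, hcol⟩ := hs
  have hle : ∀ i j, 1 ≤ i → i ≤ k → 1 ≤ j → j ≤ k → (s i j).1 ≤ n ∧ (s i j).2 ≤ n := by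
    intro i j hi hik hj hjk
    have := hSsub i j hi hik hj hjk _ (hsS i j hi hik hj hjk)
    exact ⟨this.2.1, this.2.2.2⟩
  have near : ∀ i j, 1 ≤ i → i ≤ k → 1 ≤ j → j ≤ k →
      ∀ v ∈ fivePos n i j, nearestIn B' v (bbox n i j (s i j).1 (s i j).2) := by
    intro i j hi hik hj hjk v hv
    subst hB'
    refine ⟨⟨i, j, hi, hik, hj, hjk, rfl⟩, ?_⟩
    rintro _ ⟨i', j', hi', hik', hj', hjk', rfl⟩ hb
    apply edist2_lt_edist2
    have hne : i ≠ i' ∨ j ≠ j' := by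
      by_contra! h
      obtain ⟨rfl, rfl⟩ := h
      exact hb rfl
    obtain ⟨hp, hq⟩ := hle i j hi hik hj hjk
    obtain ⟨hp', hq'⟩ := hle i' j' hi' hik' hj' hjk'
    have hx : ∀ t, IsEndCoord n i t → _ := fun t ht =>
      ht.sq_add_lt hn hp hp' hq hq' hne
        (by rintro rfl rfl; exact (hrow i j hi hik' hj hjk).symm)
        (by rintro rfl rfl; exact hrow i' j hi' hik hj hjk)
    have hy : ∀ t, IsEndCoord n j t → _ := fun t ht =>
      ht.sq_add_lt hn hq hq' hp hp' hne.symm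
        (by rintro rfl rfl; exact (hcol i j hi hik hj hjk').symm)
        (by rintro rfl rfl; exact hcol i j' hi hik hj' hjk)
    simp only [bbox_eq]
    rcases hv with rfl | rfl | rfl | rfl | rfl
    · exact sq_add_lt_of_midCoord hn hp hp' hq hq' hne
    · exact hx _ (Or.inl rfl)
    · exact hx _ (Or.inr rfl)
    · have h := hy _ (Or.inl rfl)
      rwa [add_comm, add_comm ((_ - boxCoord n j' _) ^ 2)] at h
    · have h := hy _ (Or.inr rfl)
      rwa [add_comm, add_comm ((_ - boxCoord n j' _) ^ 2)] at h
  refine ⟨near, fun b hb => ?_⟩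
  obtain ⟨i₀, j₀, hi₀, hik₀, hj₀, hjk₀, rfl⟩ : ∃ i j, 1 ≤ i ∧ i ≤ k ∧ 1 ≤ j ∧ j ≤ k ∧
      b = bbox n i j (s i j).1 (s i j).2 := by rwa [hB'] at hb
  have hiff : ∀ i ∈ Finset.Icc 1 k, ∀ j ∈ Finset.Icc 1 k, ∀ v ∈ fivePos n i j,
      (nearestIn B' v (bbox n i₀ j₀ (s i₀ j₀).1 (s i₀ j₀).2) ↔ i = i₀ ∧ j = j₀) := by
    intro i hi j hj v hv
    obtain ⟨hi, hik⟩ := Finset.mem_Icc.1 hi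
    obtain ⟨hj, hjk⟩ := Finset.mem_Icc.1 hj
    have hown := near i j hi hik hj hjk v hv
    constructor
    · intro h
      have heq := hown.eq h
      simp only [bbox_eq, Prod.mk.injEq] at heq
      obtain ⟨hp, hq⟩ := hle i j hi hik hj hjk
      obtain ⟨hp', hq'⟩ := hle i₀ j₀ hi₀ hik₀ hj₀ hjk₀
      exact ⟨boxCoord_injective hn hp hp' heq.1, boxCoord_injective hn hq hq' heq.2⟩
    · rintro ⟨rfl, rfl⟩
      exact hown
  have hone : ∑ i ∈ Finset.Icc 1 k, ∑ j ∈ Finset.Icc 1 k,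
      (if i = i₀ ∧ j = j₀ then 1 else 0) = 1 := by
    simp [ite_and, Finset.sum_ite_eq', hi₀, hik₀, hj₀, hjk₀]
  rw [← hone]
  unfold redCount blueCount
  simp only [← Finset.sum_add_distrib]
  refine Finset.sum_congr rfl fun i hi => Finset.sum_congr rfl fun j hj => ?_
  have h := hiff i hi j hj
  simp only [h (cpos n i j) (by simp [fivePos]), h (Vl n i j) (by simp [fivePos]),
    h (Vr n i j) (by simp [fivePos]), h (Vu n i j) (by simp [fivePos]),
    h (Vd n i j) (by simp [fivePos])]
  split_ifs <;> ring
end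
end

section
/- Let P be a finite set of points in the Euclidean plane ℝ², let Q ⊆ P, and let G ⊆ ℝ² be a set such that every point y ∈ G has a nearest point of P lying in Q, i.e., there exists q ∈ Q with dist(y, q) ≤ dist(y, p) for all p ∈ P. Let x ∈ ℝ² and b ∈ P, and suppose the line segment from x to b intersects G. Then there exists q ∈ Q with dist(x, q) ≤ dist(x, b). In particular, if b is the unique nearest point of P to x, then b ∈ Q. -/
/-- Claim about the separating polygon: if every point of `G` has a nearest
point of `P` lying in `Q ⊆ P`, and the segment from `x` to `b ∈ P` meets `G`,
then some `q ∈ Q` is at least as close to `x` as `b` is; in particular, if `b`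
is the unique nearest point of `P` to `x`, then `b ∈ Q`. -/
theorem closest_box_preserved (P Q G : Set (EuclideanSpace ℝ (Fin 2)))
    (hPfin : P.Finite) (hQP : Q ⊆ P)
    (hG : ∀ y ∈ G, ∃ q ∈ Q, ∀ p ∈ P, dist y q ≤ dist y p)
    (x b : EuclideanSpace ℝ (Fin 2)) (hb : b ∈ P)
    (hseg : (segment ℝ x b ∩ G).Nonempty) :
    (∃ q ∈ Q, dist x q ≤ dist x b) ∧
    ((∀ p ∈ P, p ≠ b → dist x b < dist x p) → b ∈ Q) := by
  obtain ⟨y, hy, hyG⟩ := hseg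
  obtain ⟨q, hqQ, hq⟩ := hG y hyG
  have hle : dist x q ≤ dist x b := by
    have hsplit := dist_add_dist_of_mem_segment hy
    have htri := dist_triangle x y q
    have hqb := hq b hb
    linarith
  refine ⟨⟨q, hqQ, hle⟩, fun huniq => ?_⟩
  by_cases hqb : q = b
  · exact hqb ▸ hqQ
  · exact absurd hle (huniq q (hQP hqQ) hqb).not_ge
end

section
/- Let M ≥ 1 and β ≥ 0 be real numbers, let γ ≥ 1 be a natural number, and let T : ℕ → ℝ satisfy: T(j) ≤ M^β for all j ≤ γ, and T(j) ≤ M^{β·√j} · T(⌊3j/4⌋) for all j > γ. Then for every k ∈ ℕ, T(k) ≤ M^{β·√k/(1 − √3/2) + β}. -/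
/-- Solution of the recurrence from the running-time analysis: if
`T(j) ≤ M^β` for `j ≤ γ` and `T(j) ≤ M^{β√j} · T(⌊3j/4⌋)` for `j > γ`, then
`T(k) ≤ M^{β√k/(1 − √3/2) + β}` for every `k`. -/
theorem recurrence_solution (M β : ℝ) (hM : 1 ≤ M) (hβ : 0 ≤ β)
    (γ : ℕ) (hγ : 1 ≤ γ) (T : ℕ → ℝ)
    (hbase : ∀ j : ℕ, j ≤ γ → T j ≤ M ^ β)
    (hrec : ∀ j : ℕ, γ < j → T j ≤ M ^ (β * Real.sqrt j) * T (3 * j / 4)) :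
    ∀ k : ℕ, T k ≤ M ^ (β * Real.sqrt k / (1 - Real.sqrt 3 / 2) + β) := by
  have hc : 0 < 1 - Real.sqrt 3 / 2 := by
    have : Real.sqrt 3 < 2 := by
      rw [Real.sqrt_lt' two_pos]
      norm_num
    linarith
  have hM0 : 0 < M := by linarith
  intro k
  induction k using Nat.strong_induction_on with
  | _ k ih =>
    rcases le_or_gt k γ with hk | hk
    · refine (hbase k hk).trans (Real.rpow_le_rpow_of_exponent_le hM ?_)
      have : 0 ≤ β * Real.sqrt k / (1 - Real.sqrt 3 / 2) := by positivity
      linarith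
    · have hsqrt : Real.sqrt ((3 * k / 4 : ℕ) : ℝ) ≤ Real.sqrt 3 / 2 * Real.sqrt k := by
        have hfloor : ((3 * k / 4 : ℕ) : ℝ) ≤ 3 * k / 4 := by
          simpa using Nat.cast_div_le (α := ℝ) (m := 3 * k) (n := 4)
        refine Real.sqrt_le_iff.mpr ⟨by positivity, hfloor.trans_eq ?_⟩
        rw [mul_pow, div_pow, Real.sq_sqrt (by norm_num), Real.sq_sqrt k.cast_nonneg]
        ring
      calc T k ≤ M ^ (β * Real.sqrt k) * T (3 * k / 4) := hrec k hk
        _ ≤ M ^ (β * Real.sqrt k) *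
            M ^ (β * Real.sqrt ((3 * k / 4 : ℕ) : ℝ) / (1 - Real.sqrt 3 / 2) + β) := by
          gcongr
          exact ih _ (by omega)
        _ = M ^ (β * Real.sqrt k +
            (β * Real.sqrt ((3 * k / 4 : ℕ) : ℝ) / (1 - Real.sqrt 3 / 2) + β)) :=
          (Real.rpow_add hM0 _ _).symm
        _ ≤ M ^ (β * Real.sqrt k +
            (β * (Real.sqrt 3 / 2 * Real.sqrt k) / (1 - Real.sqrt 3 / 2) + β)) := by
          refine Real.rpow_le_rpow_of_exponent_le hM ?_
          gcongr
        _ = M ^ (β * Real.sqrt k / (1 - Real.sqrt 3 / 2) + β) := by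
          congr 1
          have hne := hc.ne'
          rw [← add_assoc, add_left_inj, eq_div_iff hne, add_mul, div_mul_cancel₀ _ hne]
          ring
end
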